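/- In the Carroll Lie algebra, where [K_i, P_0] = 0 (boosts commute with time translations), the bracket table with [J,K_i]=ε_{ij}K_j, [J,P_i]=ε_{ij}P_j, [K_i,P_j]=δ_{ij}P_0, [K_i,K_j]=ε_{ij}A_exo, [P_i,P_j]=ε_{ij}A_mag, with A_exo and A_mag central, satisfies the Jacobi identity; in particular the doubly extended planar Carroll algebra is a Lie algebra for all values of the central charges. -/

import Mathlib

/-- The bracket of the doubly extended planar Carroll algebra on coordinates
`(J, K₁, K₂, P₁, P₂, P₀, A_exo, A_mag)` (indices `0,…,7`). -/
def carrollBracket (v w : Fin 8 → ℝ) : Fin 8 → ℝ :=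
  ![ 0,
     -(v 0 * w 2 - v 2 * w 0),
     (v 0 * w 1 - v 1 * w 0),
     -(v 0 * w 4 - v 4 * w 0),
     (v 0 * w 3 - v 3 * w 0),
     (v 1 * w 3 - v 3 * w 1) + (v 2 * w 4 - v 4 * w 2),
     (v 1 * w 2 - v 2 * w 1),
     (v 3 * w 4 - v 4 * w 3) ]

/-- The doubly extended planar Carroll bracket table — with `[J,K_i]=ε_{ij}K_j`,
`[J,P_i]=ε_{ij}P_j`, `[K_i,P_j]=δ_{ij}P_0`, `[K_i,K_j]=ε_{ij}A_exo`,
`[P_i,P_j]=ε_{ij}A_mag`, and `P₀`, `A_exo`, `A_mag` central — satisfies the Jacobi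
identity: the doubly extended planar Carroll algebra is a Lie algebra. -/
theorem carroll_jacobi (u v w : Fin 8 → ℝ) :
    carrollBracket u (carrollBracket v w) + carrollBracket v (carrollBracket w u)
      + carrollBracket w (carrollBracket u v) = 0 := by
  ext i
  fin_cases i <;> simp [carrollBracket] <;> ring
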